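/- arXiv:1402.3621 — 3 statements merged into one kernel-verified Lean document; each statement's English description precedes it below -/
import Mathlib

section
/- There exists an absolute constant C > 0 such that for every positive integer m which is a sum of two squares, Σ_{(μ₁,μ₂,μ₃,μ₄) ∈ E⁴, μ₁+μ₂+μ₃+μ₄ ≠ 0} 1/‖μ₁+μ₂+μ₃+μ₄‖ ≤ C · N^{5/2}, where E = {μ ∈ ℤ² : μ₁² + μ₂² = m}, N = #E, and ‖·‖ is the Euclidean norm on ℝ². -/
open MeasureTheory ProbabilityTheory Real

noncomputable section

/-- The set of lattice points on the circle of radius `√m`: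
`E = {μ ∈ ℤ² : μ₁² + μ₂² = m}` (all solutions satisfy `|μᵢ| ≤ m`). -/
def latticeSet (m : ℕ) : Finset (ℤ × ℤ) :=
  (Finset.Icc (-(m : ℤ)) (m : ℤ) ×ˢ Finset.Icc (-(m : ℤ)) (m : ℤ)).filter
    (fun μ => μ.1 ^ 2 + μ.2 ^ 2 = (m : ℤ))

/-- `N = #E`, the number of lattice points on the circle of radius `√m`. -/
def latN (m : ℕ) : ℕ := (latticeSet m).card

lemma mem_latticeSet {m : ℕ} {z : ℤ × ℤ} :
    z ∈ latticeSet m ↔ z.1 ^ 2 + z.2 ^ 2 = (m : ℤ) := by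
  simp only [latticeSet, Finset.mem_filter, Finset.mem_product, Finset.mem_Icc,
    and_iff_right_iff_imp]
  intro h
  have key : ∀ a b : ℤ, a ^ 2 + b ^ 2 = (m : ℤ) → -(m : ℤ) ≤ a ∧ a ≤ m := fun a b hab =>
    abs_le.mp ((Int.le_self_sq |a|).trans (by rw [sq_abs]; nlinarith [sq_nonneg b]))
  exact ⟨key _ _ h, key _ _ (by rw [add_comm]; exact h)⟩

/-! ### Geometry of lattice points on a circle -/

/-- The product of the squared side lengths of a triangle inscribed in a circle of squared
radius `m` is `16 m` times its squared area. -/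
lemma sides_sq_mul_eq {m x₁ y₁ x₂ y₂ x₃ y₃ : ℤ} (h₁ : x₁ ^ 2 + y₁ ^ 2 = m)
    (h₂ : x₂ ^ 2 + y₂ ^ 2 = m) (h₃ : x₃ ^ 2 + y₃ ^ 2 = m) :
    ((x₁ - x₂) ^ 2 + (y₁ - y₂) ^ 2) * ((x₂ - x₃) ^ 2 + (y₂ - y₃) ^ 2) *
        ((x₃ - x₁) ^ 2 + (y₃ - y₁) ^ 2) =
      4 * m * ((x₂ - x₁) * (y₃ - y₁) - (x₃ - x₁) * (y₂ - y₁)) ^ 2 := by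
  grind

lemma sq_add_sq_sub_pos {z w : ℤ × ℤ} (h : z ≠ w) :
    0 < (z.1 - w.1) ^ 2 + (z.2 - w.2) ^ 2 := by
  by_contra! hle
  have h1 : z.1 - w.1 = 0 := by nlinarith [sq_nonneg (z.1 - w.1), sq_nonneg (z.2 - w.2)]
  have h2 : z.2 - w.2 = 0 := by nlinarith [sq_nonneg (z.1 - w.1), sq_nonneg (z.2 - w.2)]
  exact h (Prod.ext (by lia) (by lia))

lemma det_ne_zero_of_mem_latticeSet {m : ℕ} {a b c : ℤ × ℤ} (ha : a ∈ latticeSet m)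
    (hb : b ∈ latticeSet m) (hc : c ∈ latticeSet m) (hab : a ≠ b) (hac : a ≠ c) (hbc : b ≠ c) :
    (b.1 - a.1) * (c.2 - a.2) - (c.1 - a.1) * (b.2 - a.2) ≠ 0 := by
  intro h
  have key := sides_sq_mul_eq (mem_latticeSet.mp ha) (mem_latticeSet.mp hb) (mem_latticeSet.mp hc)
  rw [h] at key
  have := mul_pos (mul_pos (sq_add_sq_sub_pos hab) (sq_add_sq_sub_pos hbc))
    (sq_add_sq_sub_pos hac.symm)
  lia

lemma sq_add_sq_sub_le {c₁ c₂ x₁ y₁ x₂ y₂ s : ℤ} (h₁ : (c₁ + x₁) ^ 2 + (c₂ + y₁) ^ 2 ≤ s)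
    (h₂ : (c₁ + x₂) ^ 2 + (c₂ + y₂) ^ 2 ≤ s) : (x₁ - x₂) ^ 2 + (y₁ - y₂) ^ 2 ≤ 4 * s := by
  linarith [sq_nonneg ((c₁ + x₁) + (c₁ + x₂)), sq_nonneg ((c₂ + y₁) + (c₂ + y₂))]

/-- A disc of radius `√s` with `16 s³ < m` contains at most two lattice points of the circle of
radius `√m`. -/
lemma card_filter_dist_le_two {m s : ℕ} (hm : 16 * s ^ 3 < m) (c : ℤ × ℤ) :
    ((latticeSet m).filter fun z => (c + z).1 ^ 2 + (c + z).2 ^ 2 ≤ (s : ℤ)).card ≤ 2 := by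
  by_contra! hcard
  obtain ⟨p, q, r, hp, hq, hr, hpq, hpr, hqr⟩ := Finset.two_lt_card_iff.mp hcard
  simp only [Finset.mem_filter, Prod.fst_add, Prod.snd_add] at hp hq hr
  have key := sides_sq_mul_eq (mem_latticeSet.mp hp.1) (mem_latticeSet.mp hq.1)
    (mem_latticeSet.mp hr.1)
  have hdet := det_ne_zero_of_mem_latticeSet hp.1 hq.1 hr.1 hpq hpr hqr
  have hle := mul_le_mul (mul_le_mul (sq_add_sq_sub_le hp.2 hq.2) (sq_add_sq_sub_le hq.2 hr.2)
    (by positivity) (by positivity)) (sq_add_sq_sub_le hr.2 hp.2) (by positivity) (by positivity)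
  have hone : 1 ≤ ((q.1 - p.1) * (r.2 - p.2) - (r.1 - p.1) * (q.2 - p.2)) ^ 2 :=
    Int.add_one_le_iff.mpr (sq_pos_iff.mpr hdet)
  have hm' : 16 * (s : ℤ) ^ 3 < m := by exact_mod_cast hm
  have hmul := mul_le_mul_of_nonneg_left hone (by positivity : (0 : ℤ) ≤ 4 * m)
  rw [← key] at hmul
  have := hmul.trans hle
  ring_nf at this hm'
  lia

/-- A nonzero vector is a sum of two points of the circle in at most two ways. -/
lemma card_filter_sub_mem_le_two {m : ℕ} {w : ℤ × ℤ} (hw : w ≠ 0) :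
    ((latticeSet m).filter fun z => w - z ∈ latticeSet m).card ≤ 2 := by
  by_contra! hcard
  obtain ⟨p, q, r, hp, hq, hr, hpq, hpr, hqr⟩ := Finset.two_lt_card_iff.mp hcard
  simp only [Finset.mem_filter] at hp hq hr
  have hdet := det_ne_zero_of_mem_latticeSet hp.1 hq.1 hr.1 hpq hpr hqr
  have lin : ∀ z ∈ latticeSet m, w - z ∈ latticeSet m →
      2 * (w.1 * z.1 + w.2 * z.2) = w.1 ^ 2 + w.2 ^ 2 := fun z hz hz' => by
    rw [mem_latticeSet] at hz hz'
    simp only [Prod.fst_sub, Prod.snd_sub] at hz'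
    linarith
  have h1 := lin p hp.1 hp.2
  have h2 := lin q hq.1 hq.2
  have h3 := lin r hr.1 hr.2
  have e1 : w.1 * (q.1 - p.1) + w.2 * (q.2 - p.2) = 0 := by linarith
  have e2 : w.1 * (r.1 - p.1) + w.2 * (r.2 - p.2) = 0 := by linarith
  refine hw (Prod.ext ?_ ?_)
  · refine (mul_eq_zero.mp ?_).resolve_right hdet
    linear_combination (r.2 - p.2) * e1 - (q.2 - p.2) * e2
  · refine (mul_eq_zero.mp ?_).resolve_right hdet
    linear_combination (q.1 - p.1) * e2 - (r.1 - p.1) * e1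

lemma sum_sum_add_eq_card {m : ℕ} (w : ℤ × ℤ) :
    (∑ a ∈ latticeSet m, ∑ b ∈ latticeSet m, if a + b = w then 1 else 0) =
      ((latticeSet m).filter fun z => w - z ∈ latticeSet m).card := by
  rw [Finset.card_filter]
  refine Finset.sum_congr rfl fun a _ => ?_
  simp only [← eq_sub_iff_add_eq', Finset.sum_ite_eq']

/-- A nonzero vector is a sum of four points of the circle in at most `4 N ^ 2` ways. -/
lemma sum_four_eq_le {m : ℕ} {v : ℤ × ℤ} (hv : v ≠ 0) :
    (∑ a ∈ latticeSet m, ∑ b ∈ latticeSet m, ∑ c ∈ latticeSet m, ∑ d ∈ latticeSet m,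
      if a + b + c + d = v then 1 else 0) ≤ 4 * latN m ^ 2 := by
  have inner : ∀ a b : ℤ × ℤ, (∑ c ∈ latticeSet m, ∑ d ∈ latticeSet m,
      if a + b + c + d = v then 1 else 0) ≤ 2 + latN m * if a + b = v then 1 else 0 := by
    intro a b
    have : ∀ c d : ℤ × ℤ, a + b + c + d = v ↔ c + d = v - (a + b) := fun c d => by
      rw [eq_sub_iff_add_eq', add_assoc]
    simp only [this, sum_sum_add_eq_card]
    split_ifs with h
    · have : _ ≤ latN m := Finset.card_filter_le (latticeSet m)
        fun z => v - (a + b) - z ∈ latticeSet m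
      lia
    · have := card_filter_sub_mem_le_two (m := m) (sub_ne_zero.mpr (Ne.symm h))
      lia
  have h2 := (sum_sum_add_eq_card (m := m) v).trans_le (card_filter_sub_mem_le_two hv)
  calc _ ≤ ∑ a ∈ latticeSet m, ∑ b ∈ latticeSet m, (2 + latN m * if a + b = v then 1 else 0) :=
        Finset.sum_le_sum fun a _ => Finset.sum_le_sum fun b _ => inner a b
    _ = 2 * latN m ^ 2 + latN m * ∑ a ∈ latticeSet m, ∑ b ∈ latticeSet m,
          (if a + b = v then 1 else 0) := by
        simp only [Finset.sum_add_distrib, Finset.mul_sum, Finset.sum_const, latN, smul_eq_mul]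
        ring
    _ ≤ 2 * latN m ^ 2 + latN m * 2 := by gcongr
    _ ≤ 4 * latN m ^ 2 := by nlinarith [Nat.le_self_pow two_ne_zero (latN m)]

/-! ### The number of lattice points on a circle -/

lemma latN_two_mul_le (n : ℕ) : latN (2 * n) ≤ latN n := by
  have par : ∀ z : ℤ × ℤ, z.1 ^ 2 + z.2 ^ 2 = 2 * (n : ℤ) → (z.1 + z.2) % 2 = 0 := fun z h => by
    have : (z.1 + z.2) ^ 2 = 2 * (n + z.1 * z.2) := by linear_combination h
    exact Int.emod_eq_zero_of_dvd (Int.prime_two.dvd_of_dvd_pow (Dvd.intro _ this.symm))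
  refine Finset.card_le_card_of_injOn (fun z => ((z.1 + z.2) / 2, (z.1 - z.2) / 2)) ?_ ?_
  · intro z hz
    have h := mem_latticeSet.mp (Finset.mem_coe.mp hz)
    push_cast at h
    have hpar := par z h
    obtain ⟨s, hs⟩ : ∃ s, z.1 + z.2 = 2 * s := ⟨(z.1 + z.2) / 2, by lia⟩
    obtain ⟨t, ht⟩ : ∃ t, z.1 - z.2 = 2 * t := ⟨(z.1 - z.2) / 2, by lia⟩
    refine Finset.mem_coe.mpr (mem_latticeSet.mpr ?_)
    simp only [hs, ht]
    rw [Int.mul_ediv_cancel_left _ two_ne_zero, Int.mul_ediv_cancel_left _ two_ne_zero]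
    have h1 : z.1 = s + t := by lia
    have h2 : z.2 = s - t := by lia
    rw [h1, h2] at h
    linarith
  · intro z hz w hw h
    have hz := mem_latticeSet.mp (Finset.mem_coe.mp hz)
    have hw := mem_latticeSet.mp (Finset.mem_coe.mp hw)
    push_cast at hz hw
    have := par z hz
    have := par w hw
    simp only [Prod.mk.injEq] at h
    exact Prod.ext (by lia) (by lia)

/-- For an odd prime `p`, a Gaussian integer whose norm is divisible by `p ^ k` is divisible by `p`,
or by the `k`-th power of one of the two conjugate Gaussian primes above `p`. -/
lemma exists_dvd_or_pow_dvd {p : ℕ} (hp : p.Prime) (hp2 : p ≠ 2) :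
    ∃ ρ : GaussianInt, ∀ (k : ℕ) (z : GaussianInt), k ≠ 0 → (p : ℤ) ^ k ∣ z.norm →
      (p : GaussianInt) ∣ z ∨
        ρ.norm = p ∧ (ρ ^ k ∣ z ∨ star ρ ^ k ∣ z) := by
  have hcast : ∀ (k : ℕ) (z : GaussianInt), (p : ℤ) ^ k ∣ z.norm →
      (p : GaussianInt) ^ k ∣ z * star z := fun k z h => by
    rw [← Zsqrtd.norm_eq_mul_conj]
    simpa using map_dvd (Int.castRingHom GaussianInt) h
  have : Fact p.Prime := ⟨hp⟩
  have star_dvd : ∀ x y : GaussianInt, x ∣ star y → star x ∣ y := fun x y h => by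
    simpa only [starRingEnd_apply, star_star] using map_dvd (starRingEnd GaussianInt) h
  by_cases hirr : Irreducible (p : GaussianInt)
  · refine ⟨1, fun k z hk h => Or.inl ?_⟩
    rcases hirr.prime.dvd_or_dvd ((dvd_pow_self _ hk).trans (hcast k z h)) with h | h
    · exact h
    · simpa using star_dvd _ _ h
  obtain ⟨a, b, hab⟩ := GaussianInt.sq_add_sq_of_nat_prime_of_not_irreducible p hirr
  set ρ : GaussianInt := ⟨a, b⟩ with hρ
  have hnorm : ρ.norm = p := by
    rw [Zsqrtd.norm_def, ← hab]; push_cast; ring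
  have hnorm' : (star ρ).norm = p := by rw [Zsqrtd.norm_conj, hnorm]
  have prime_of_norm : ∀ x : GaussianInt, x.norm = p → Prime x := fun x hx => by
    refine Irreducible.prime ⟨fun h => ?_, fun u v huv => ?_⟩
    · rw [← Zsqrtd.norm_eq_one_iff, hx] at h
      exact hp.one_lt.ne' (by simpa using h)
    · have : p = u.norm.natAbs * v.norm.natAbs := by
        rw [← Int.natAbs_mul, ← Zsqrtd.norm_mul, ← huv, hx, Int.natAbs_natCast]
      rw [← Zsqrtd.norm_eq_one_iff, ← Zsqrtd.norm_eq_one_iff]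
      rcases Nat.prime_mul_iff.mp (this ▸ hp) with h | h
      · exact Or.inr h.2
      · exact Or.inl h.2
  have hprime := prime_of_norm ρ hnorm
  have hprime' := prime_of_norm (star ρ) hnorm'
  have hp_eq : (p : GaussianInt) = ρ * star ρ := by
    rw [← Zsqrtd.norm_eq_mul_conj, hnorm, Int.cast_natCast]
  refine ⟨ρ, fun k z hk h => ?_⟩
  have hdvd := hcast k z h
  have hρk : ρ ^ k ∣ z * star z := (pow_dvd_pow_of_dvd (Dvd.intro _ hp_eq.symm) k).trans hdvd
  by_cases h1 : ρ ∣ star z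
  · by_cases h2 : ρ ∣ z
    · left
      have h3 : star ρ ∣ z := star_dvd _ _ h1
      obtain ⟨w, rfl⟩ := h2
      rw [hp_eq]
      refine mul_dvd_mul_left ρ ((hprime'.dvd_or_dvd h3).resolve_left fun h4 => ?_)
      have h5 : star ρ ∣ ((2 * a : ℤ) : GaussianInt) := by
        have : ((2 * a : ℤ) : GaussianInt) = ρ + star ρ := by
          ext <;> simp [hρ, two_mul]
        rw [this]
        exact dvd_add h4 dvd_rfl
      obtain ⟨t, ht⟩ := h5
      have h6 : (p : ℤ) ∣ (2 * a) * (2 * a) := by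
        have := congrArg Zsqrtd.norm ht
        rw [Zsqrtd.norm_mul, Zsqrtd.norm_intCast, hnorm'] at this
        exact Dvd.intro _ this.symm
      have hpi : Prime (p : ℤ) := Nat.prime_iff_prime_int.mp hp
      have h7 : (p : ℤ) ∣ 2 * a := (hpi.dvd_or_dvd h6).elim id id
      have h8 : p ∣ a := by
        rcases hpi.dvd_or_dvd h7 with h | h
        · exact absurd ((Nat.prime_dvd_prime_iff_eq hp Nat.prime_two).mp (by exact_mod_cast h)) hp2
        · exact_mod_cast h
      have h9 : p ∣ b := by
        refine hp.dvd_of_dvd_pow (n := 2)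
          ((Nat.dvd_add_right (h8.trans (dvd_pow_self a two_ne_zero))).mp ?_)
        rw [hab]
      have h10 : p ^ 2 ∣ p := by
        conv_rhs => rw [← hab]
        exact dvd_add (pow_dvd_pow_of_dvd h8 2) (pow_dvd_pow_of_dvd h9 2)
      have := Nat.le_of_dvd hp.pos h10
      nlinarith [hp.two_le]
    · have h3 : ρ ^ k ∣ star z := hprime.pow_dvd_of_dvd_mul_left k h2 hρk
      exact Or.inr ⟨hnorm, Or.inr (by simpa only [star_pow] using star_dvd _ _ h3)⟩
  · exact Or.inr ⟨hnorm, Or.inl (hprime.pow_dvd_of_dvd_mul_right k h1 hρk)⟩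

lemma mem_latticeSet_iff_norm {m : ℕ} {z : ℤ × ℤ} :
    z ∈ latticeSet m ↔ (⟨z.1, z.2⟩ : GaussianInt).norm = m := by
  rw [mem_latticeSet, Zsqrtd.norm_def]
  constructor <;> intro h <;> linarith

/-- Points of `latticeSet m` divisible by a Gaussian integer of norm `d` come from
`latticeSet n`, where `m = d * n`. -/
lemma card_filter_dvd_le {m d n : ℕ} (hd : d ≠ 0) (hm : m = d * n) {x : GaussianInt}
    (hx : x.norm = d) [DecidablePred fun z : ℤ × ℤ => x ∣ (⟨z.1, z.2⟩ : GaussianInt)] :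
    ((latticeSet m).filter fun z => x ∣ (⟨z.1, z.2⟩ : GaussianInt)).card ≤ latN n := by
  refine le_trans (Finset.card_le_card ?_) (Finset.card_image_le (s := latticeSet n)
    (f := fun w => ((x * ⟨w.1, w.2⟩ : GaussianInt).re, (x * ⟨w.1, w.2⟩ : GaussianInt).im)))
  intro z hz
  obtain ⟨hz, w, hw⟩ := Finset.mem_filter.mp hz
  rw [mem_latticeSet_iff_norm, hw, Zsqrtd.norm_mul, hx, hm, Nat.cast_mul] at hz
  refine Finset.mem_image.mpr ⟨(w.re, w.im), mem_latticeSet_iff_norm.mpr ?_, ?_⟩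
  · exact mul_left_cancel₀ (by exact_mod_cast hd) hz
  · exact Prod.ext (congrArg Zsqrtd.re hw).symm (congrArg Zsqrtd.im hw).symm

open Classical in
lemma latN_prime_pow_mul_le_add {p : ℕ} (hp : p.Prime) (hp2 : p ≠ 2) (k n : ℕ) (hk : k ≠ 0) :
    latN (p ^ k * n) ≤ ((latticeSet (p ^ k * n)).filter
      fun z => (p : GaussianInt) ∣ ⟨z.1, z.2⟩).card + 2 * latN n := by
  obtain ⟨ρ, hρ⟩ := exists_dvd_or_pow_dvd hp hp2
  by_cases hnorm : ρ.norm = p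
  · have hsub : latticeSet (p ^ k * n) ⊆
        ((latticeSet (p ^ k * n)).filter fun z => (p : GaussianInt) ∣ ⟨z.1, z.2⟩) ∪
        (((latticeSet (p ^ k * n)).filter fun z => ρ ^ k ∣ (⟨z.1, z.2⟩ : GaussianInt)) ∪
        ((latticeSet (p ^ k * n)).filter fun z => star ρ ^ k ∣ (⟨z.1, z.2⟩ : GaussianInt))) := by
      intro z hz
      have hz' := mem_latticeSet_iff_norm.mp hz
      have := hρ k ⟨z.1, z.2⟩ hk (by rw [hz']; push_cast; exact dvd_mul_right _ _)
      simp only [Finset.mem_union, Finset.mem_filter, hz, true_and]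
      tauto
    have npow : ∀ (x : GaussianInt), x.norm = p → (x ^ k).norm = (p ^ k : ℕ) := fun x hx => by
      have := map_pow (Zsqrtd.normMonoidHom (d := -1)) x k
      rw [Nat.cast_pow, ← hx]
      exact this
    have hpk : p ^ k ≠ 0 := pow_ne_zero _ hp.ne_zero
    have h1 := card_filter_dvd_le hpk rfl (n := n) (npow ρ hnorm)
    have h2 := card_filter_dvd_le hpk rfl (n := n)
      (npow (star ρ) (by rw [Zsqrtd.norm_conj, hnorm]))
    have := (Finset.card_le_card hsub).trans (Finset.card_union_le _ _)
    have := Finset.card_union_le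
      ((latticeSet (p ^ k * n)).filter fun z => ρ ^ k ∣ (⟨z.1, z.2⟩ : GaussianInt))
      ((latticeSet (p ^ k * n)).filter fun z => star ρ ^ k ∣ (⟨z.1, z.2⟩ : GaussianInt))
    rw [latN]
    lia
  · rw [Finset.filter_true_of_mem fun z hz => ?_]
    · exact Nat.le_add_right _ _
    · have hz' := mem_latticeSet_iff_norm.mp hz
      exact (hρ k ⟨z.1, z.2⟩ hk (by rw [hz']; push_cast; exact dvd_mul_right _ _)).resolve_right
        fun h => hnorm h.1

lemma norm_natCast_gaussianInt (p : ℕ) : (p : GaussianInt).norm = (p ^ 2 : ℕ) := by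
  rw [Zsqrtd.norm_natCast, sq, Nat.cast_mul]

lemma latN_prime_pow_mul_le {p : ℕ} (hp : p.Prime) {n : ℕ} (hn : ¬ p ∣ n) (k : ℕ) :
    latN (p ^ k * n) ≤ (k + 1) * latN n := by
  classical
  rcases eq_or_ne p 2 with rfl | hp2
  · have : latN (2 ^ k * n) ≤ latN n := by
      induction k with
      | zero => simp
      | succ k ih =>
        rw [pow_succ', mul_assoc]
        exact (latN_two_mul_le _).trans ih
    nlinarith
  induction k using Nat.twoStepInduction with
  | zero => simp
  | one =>
    have h := latN_prime_pow_mul_le_add hp hp2 1 n one_ne_zero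
    rw [Finset.filter_false_of_mem fun z hz => ?_] at h
    · simpa using h
    · rintro ⟨w, hw⟩
      rw [mem_latticeSet_iff_norm, hw, Zsqrtd.norm_mul, norm_natCast_gaussianInt, pow_one] at hz
      push_cast at hz
      rw [sq, mul_assoc] at hz
      have := mul_left_cancel₀ (by exact_mod_cast hp.ne_zero) hz
      exact hn (Int.natCast_dvd_natCast.mp (Dvd.intro _ this))
  | more k ih _ =>
    have h := latN_prime_pow_mul_le_add hp hp2 (k + 2) n (by lia)
    have h2 := card_filter_dvd_le (m := p ^ (k + 2) * n) (d := p ^ 2) (n := p ^ k * n)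
      (pow_ne_zero _ hp.ne_zero) (by ring) (norm_natCast_gaussianInt p)
    lia

lemma succ_pow_ten_le (k : ℕ) : (k + 1) ^ 10 ≤ Nat.factorial 10 * 2 ^ 10 * 2 ^ k := by
  have h1 : (k + 1) ^ 10 ≤ (k + 10).descFactorial 10 := by
    simpa using Nat.pow_sub_le_descFactorial (k + 10) 10
  rw [Nat.descFactorial_eq_factorial_mul_choose] at h1
  have h2 := Nat.choose_le_two_pow (k + 10) 10
  calc _ ≤ Nat.factorial 10 * 2 ^ (k + 10) := h1.trans (by gcongr)
    _ = _ := by ring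

lemma latN_pow_ten_le_of_forall {M : ℕ} (hM : ∀ k, (k + 1) ^ 10 ≤ M * 2 ^ k) (n : ℕ)
    (hn : n ≠ 0) :
    latN n ^ 10 ≤ 4 ^ 10 * M ^ (n.primeFactors.filter (· < 2 ^ 10)).card * n := by
  induction n using Nat.recOnPrimePow with
  | zero => exact absurd rfl hn
  | one =>
    have : latN 1 = 4 := by decide
    simp [this]
  | prime_pow_mul a p k hp hpa hk ih =>
    have ha : a ≠ 0 := fun h => hpa (h ▸ dvd_zero p)
    have hpf : (p ^ k * a).primeFactors = insert p a.primeFactors := by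
      rw [Nat.primeFactors_mul (pow_ne_zero _ hp.ne_zero) ha, Nat.primeFactors_prime_pow hk.ne' hp]
      rfl
    have hstep : latN (p ^ k * a) ^ 10 ≤ (k + 1) ^ 10 * latN a ^ 10 := by
      rw [← mul_pow]
      exact Nat.pow_le_pow_left (latN_prime_pow_mul_le hp hpa k) 10
    refine hstep.trans ((Nat.mul_le_mul_left _ (ih ha)).trans ?_)
    rw [hpf, Finset.filter_insert]
    split_ifs with hlt
    · rw [Finset.card_insert_of_notMem (by simp [hpa])]
      have h1 : (k + 1) ^ 10 ≤ M * p ^ k := (hM k).trans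
        (Nat.mul_le_mul_left _ (Nat.pow_le_pow_left hp.two_le k))
      refine (Nat.mul_le_mul_right _ h1).trans_eq ?_
      ring
    · have h1 : (k + 1) ^ 10 ≤ p ^ k := calc
        (k + 1) ^ 10 ≤ (2 ^ k) ^ 10 := Nat.pow_le_pow_left Nat.lt_two_pow_self 10
        _ = (2 ^ 10) ^ k := pow_right_comm _ _ _
        _ ≤ p ^ k := Nat.pow_le_pow_left (not_lt.mp hlt) k
      refine (Nat.mul_le_mul_right _ h1).trans_eq ?_
      ring

/-- The number of lattice points on the circle of radius `√n` is `O(n ^ (1 / 10))`. -/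
lemma exists_latN_pow_ten_le : ∃ C : ℕ, ∀ n : ℕ, n ≠ 0 → latN n ^ 10 ≤ C * n := by
  obtain ⟨M, hM⟩ : ∃ M : ℕ, ∀ k, (k + 1) ^ 10 ≤ M * 2 ^ k := ⟨_, succ_pow_ten_le⟩
  have hMpos : 0 < M := by simpa [Nat.one_le_iff_ne_zero, Nat.pos_iff_ne_zero] using hM 0
  refine ⟨4 ^ 10 * M ^ (2 ^ 10), fun n hn => (latN_pow_ten_le_of_forall hM n hn).trans ?_⟩
  have hcard : (n.primeFactors.filter (· < 2 ^ 10)).card ≤ 2 ^ 10 := by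
    refine (Finset.card_le_card (t := Finset.range (2 ^ 10)) fun p hp => ?_).trans_eq
      (Finset.card_range _)
    exact Finset.mem_range.mpr (Finset.mem_filter.mp hp).2
  gcongr

/-! ### The quadruple sum -/

/-- The reciprocal of the Euclidean norm of a vector of `ℤ²`, and `0` for the zero vector. -/
def invNorm (v : ℤ × ℤ) : ℝ :=
  if v ≠ 0 then (√((v.1 : ℝ) ^ 2 + (v.2 : ℝ) ^ 2))⁻¹ else 0

lemma invNorm_nonneg (v : ℤ × ℤ) : 0 ≤ invNorm v := by
  unfold invNorm; split_ifs <;> positivity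

lemma invNorm_le_of_sq_le {v : ℤ × ℤ} {t : ℝ} (ht : 0 < t)
    (h : t ^ 2 ≤ (v.1 : ℝ) ^ 2 + (v.2 : ℝ) ^ 2) : invNorm v ≤ t⁻¹ := by
  unfold invNorm
  split_ifs
  · gcongr
    exact Real.le_sqrt_of_sq_le h
  · positivity

lemma invNorm_le_one (v : ℤ × ℤ) : invNorm v ≤ 1 := by
  by_cases hv : v = 0
  · simp [invNorm, hv]
  · refine (invNorm_le_of_sq_le one_pos ?_).trans_eq inv_one
    have := sq_add_sq_sub_pos hv
    simp only [Prod.fst_zero, Prod.snd_zero, sub_zero] at this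
    rw [one_pow]
    exact_mod_cast this

/-- Splitting of `invNorm` into a long, a medium and a short range. -/
lemma invNorm_le {N : ℕ} (hN : 0 < N) (v : ℤ × ℤ) :
    invNorm v ≤ (√N ^ 3)⁻¹ + (√N)⁻¹ * (if v.1 ^ 2 + v.2 ^ 2 ≤ ((N ^ 3 : ℕ) : ℤ) then 1 else 0) +
      ∑ k ∈ Finset.Icc 1 (Nat.sqrt N), ∑ u ∈ (Finset.box k : Finset (ℤ × ℤ)),
        (k : ℝ)⁻¹ * (if v = u then 1 else 0) := by
  have hx : 0 < √(N : ℝ) := by positivity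
  have hx2 : √(N : ℝ) ^ 2 = N := Real.sq_sqrt (Nat.cast_nonneg N)
  have hS : 0 ≤ ∑ k ∈ Finset.Icc 1 (Nat.sqrt N), ∑ u ∈ (Finset.box k : Finset (ℤ × ℤ)),
      (k : ℝ)⁻¹ * (if v = u then 1 else 0) :=
    Finset.sum_nonneg fun _ _ => Finset.sum_nonneg fun _ _ => by positivity
  have h3 : 0 ≤ (√(N : ℝ) ^ 3)⁻¹ := by positivity
  have h1 : 0 ≤ (√(N : ℝ))⁻¹ := by positivity
  by_cases hlong : v.1 ^ 2 + v.2 ^ 2 ≤ ((N ^ 3 : ℕ) : ℤ)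
  · rw [if_pos hlong, mul_one]
    by_cases hmed : (N : ℤ) ≤ v.1 ^ 2 + v.2 ^ 2
    · have := invNorm_le_of_sq_le (v := v) hx (by rw [hx2]; exact_mod_cast hmed)
      linarith
    · push Not at hmed
      by_cases hv : v = 0
      · rw [invNorm, if_neg (not_not.mpr hv)]
        positivity
      set k := max v.1.natAbs v.2.natAbs with hk
      have hk0 : 0 < k := by
        by_contra! h
        exact hv (Prod.ext (by simp; lia) (by simp; lia))
      have hksq : (k : ℤ) ^ 2 ≤ v.1 ^ 2 + v.2 ^ 2 := by
        rcases max_choice v.1.natAbs v.2.natAbs with h | h <;>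
          rw [hk, h, Int.natCast_natAbs, sq_abs] <;>
          nlinarith [sq_nonneg v.1, sq_nonneg v.2]
      have hkT : k ≤ Nat.sqrt N := by
        rw [Nat.le_sqrt']
        exact_mod_cast (hksq.trans hmed.le)
      have hle : invNorm v ≤ (k : ℝ)⁻¹ :=
        invNorm_le_of_sq_le (by positivity) (by exact_mod_cast hksq)
      have hterm : (k : ℝ)⁻¹ ≤ ∑ k ∈ Finset.Icc 1 (Nat.sqrt N),
          ∑ u ∈ (Finset.box k : Finset (ℤ × ℤ)), (k : ℝ)⁻¹ * (if v = u then 1 else 0) := by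
        refine le_trans ?_ (Finset.single_le_sum (fun _ _ => Finset.sum_nonneg fun _ _ => ?_)
          (Finset.mem_Icc.mpr ⟨hk0, hkT⟩))
        · rw [← Finset.mul_sum, Finset.sum_ite_eq, if_pos (Int.mem_box.mpr hk.symm), mul_one]
        · positivity
      linarith
  · push Not at hlong
    have := invNorm_le_of_sq_le (v := v) (pow_pos hx 3) (by
      rw [← pow_mul, mul_comm, pow_mul, hx2]; exact_mod_cast hlong.le)
    rw [if_neg (not_le.mpr hlong)]
    linarith

lemma sum_invNorm_le_of_lt {m : ℕ} (hN : 0 < latN m) (hm : 16 * latN m ^ 9 < m) :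
    ∑ a ∈ latticeSet m, ∑ b ∈ latticeSet m, ∑ c ∈ latticeSet m, ∑ d ∈ latticeSet m,
      invNorm (a + b + c + d) ≤ 35 * √(latN m) ^ 5 := by
  set N := latN m with hNdef
  have hx : 0 < √(N : ℝ) := by positivity
  have hx2 : (N : ℝ) = √(N : ℝ) ^ 2 := (Real.sq_sqrt (Nat.cast_nonneg N)).symm
  have hmed : ∀ c : ℤ × ℤ, ∑ d ∈ latticeSet m,
      (if (c + d).1 ^ 2 + (c + d).2 ^ 2 ≤ ((N ^ 3 : ℕ) : ℤ) then (1 : ℝ) else 0) ≤ 2 := fun c => by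
    rw [Finset.sum_boole]
    exact_mod_cast card_filter_dist_le_two (by rwa [← pow_mul]) c
  have hshort : ∀ u : ℤ × ℤ, u ≠ 0 →
      ∑ a ∈ latticeSet m, ∑ b ∈ latticeSet m, ∑ c ∈ latticeSet m, ∑ d ∈ latticeSet m,
        (if a + b + c + d = u then (1 : ℝ) else 0) ≤ 4 * N ^ 2 := fun u hu => by
    exact_mod_cast sum_four_eq_le hu
  have hT : (Nat.sqrt N : ℝ) ≤ √N := Real.nat_sqrt_le_real_sqrt
  calc _ ≤ ∑ a ∈ latticeSet m, ∑ b ∈ latticeSet m, ∑ c ∈ latticeSet m, ∑ d ∈ latticeSet m, _ :=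
        Finset.sum_le_sum fun a _ => Finset.sum_le_sum fun b _ => Finset.sum_le_sum fun c _ =>
          Finset.sum_le_sum fun d _ => invNorm_le hN (a + b + c + d)
    _ = N ^ 4 * (√N ^ 3)⁻¹ + (√N)⁻¹ * (∑ a ∈ latticeSet m, ∑ b ∈ latticeSet m,
          ∑ c ∈ latticeSet m, ∑ d ∈ latticeSet m, if (a + b + c + d).1 ^ 2 +
            (a + b + c + d).2 ^ 2 ≤ ((N ^ 3 : ℕ) : ℤ) then (1 : ℝ) else 0) +
        ∑ k ∈ Finset.Icc 1 (Nat.sqrt N), ∑ u ∈ (Finset.box k : Finset (ℤ × ℤ)), (k : ℝ)⁻¹ *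
          ∑ a ∈ latticeSet m, ∑ b ∈ latticeSet m, ∑ c ∈ latticeSet m, ∑ d ∈ latticeSet m,
            if a + b + c + d = u then (1 : ℝ) else 0 := by
        simp only [Finset.sum_add_distrib]
        congr 1
        · congr 1
          · simp only [Finset.sum_const, nsmul_eq_mul, hNdef, latN]
            ring
          · simp only [Finset.mul_sum]
        · simp only [Finset.mul_sum, Finset.sum_comm (s := latticeSet m) (t := Finset.Icc 1 _),
            Finset.sum_comm (s := latticeSet m) (t := Finset.box _)]
    _ ≤ N ^ 4 * (√N ^ 3)⁻¹ + (√N)⁻¹ * (∑ a ∈ latticeSet m, ∑ b ∈ latticeSet m,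
          ∑ c ∈ latticeSet m, 2) +
        ∑ k ∈ Finset.Icc 1 (Nat.sqrt N), ∑ u ∈ (Finset.box k : Finset (ℤ × ℤ)), (k : ℝ)⁻¹ *
          (4 * N ^ 2) := by
        gcongr with a _ b _ c _ k hk u hu
        · exact hmed (a + b + c)
        · refine hshort u fun h => ?_
          rw [h, Finset.zero_mem_box] at hu
          exact absurd (Finset.mem_Icc.mp hk).1 (by lia)
    _ = N ^ 4 * (√N ^ 3)⁻¹ + (√N)⁻¹ * (2 * N ^ 3) + 32 * Nat.sqrt N * N ^ 2 := by
        congr 1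
        · simp only [Finset.sum_const, nsmul_eq_mul, hNdef, latN]
          ring
        · rw [Finset.sum_congr rfl (g := fun _ => 32 * (N : ℝ) ^ 2) fun k hk => ?_]
          · simp only [Finset.sum_const, nsmul_eq_mul, Nat.card_Icc, Nat.add_sub_cancel]
            ring
          · have hk0 : k ≠ 0 := by have := (Finset.mem_Icc.mp hk).1; lia
            have hk0' : (k : ℝ) ≠ 0 := by exact_mod_cast hk0
            rw [Finset.sum_const, Int.card_box hk0, nsmul_eq_mul]
            push_cast
            field_simp
            norm_num
    _ ≤ N ^ 4 * (√N ^ 3)⁻¹ + (√N)⁻¹ * (2 * N ^ 3) + 32 * √N * N ^ 2 := by gcongr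
    _ = 35 * √N ^ 5 := by
        generalize √(N : ℝ) = x at hx hx2
        rw [hx2]
        field_simp
        norm_num

/-- The quadruple lattice-point sum `∑ 1/‖μ₁+μ₂+μ₃+μ₄‖` over nonzero sums is `O(N^{5/2})`. -/
theorem quadruple_sum_bound :
    ∃ C > 0, ∀ m : ℕ, 0 < m →
      (∃ a b : ℤ, a ^ 2 + b ^ 2 = (m : ℤ)) →
      (∑ μ₁ ∈ latticeSet m, ∑ μ₂ ∈ latticeSet m, ∑ μ₃ ∈ latticeSet m, ∑ μ₄ ∈ latticeSet m,
          if μ₁ + μ₂ + μ₃ + μ₄ ≠ (0 : ℤ × ℤ) then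
            (Real.sqrt ((((μ₁ + μ₂ + μ₃ + μ₄).1 : ℝ)) ^ 2 +
              (((μ₁ + μ₂ + μ₃ + μ₄).2 : ℝ)) ^ 2))⁻¹
          else 0)
        ≤ C * (latN m : ℝ) ^ ((5:ℝ)/2) := by
  obtain ⟨K, hK⟩ := exists_latN_pow_ten_le
  refine ⟨35 + (16 * K) ^ 2, by positivity, fun m hm ⟨a, b, hab⟩ => ?_⟩
  have hN : 0 < latN m := Finset.card_pos.mpr ⟨(a, b), mem_latticeSet.mpr hab⟩
  set N := latN m with hNdef
  have hx : 0 < √(N : ℝ) := by positivity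
  have hx2 : (N : ℝ) = √(N : ℝ) ^ 2 := (Real.sq_sqrt (Nat.cast_nonneg N)).symm
  have hpow : (N : ℝ) ^ ((5 : ℝ) / 2) = √N ^ 5 := by
    rw [Real.sqrt_eq_rpow, ← Real.rpow_natCast, ← Real.rpow_mul (Nat.cast_nonneg N)]
    norm_num
  rw [hpow]
  change ∑ μ₁ ∈ latticeSet m, ∑ μ₂ ∈ latticeSet m, ∑ μ₃ ∈ latticeSet m, ∑ μ₄ ∈ latticeSet m,
    invNorm (μ₁ + μ₂ + μ₃ + μ₄) ≤ _
  rcases lt_or_ge (16 * N ^ 9) m with hlt | hge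
  · refine (sum_invNorm_le_of_lt hN hlt).trans ?_
    gcongr
    exact le_add_of_nonneg_right (by positivity)
  · have hNK : N ≤ 16 * K := by
      refine Nat.le_of_mul_le_mul_left ?_ (pow_pos hN 9)
      calc N ^ 9 * N = N ^ 10 := by ring
        _ ≤ K * m := hK m hm.ne'
        _ ≤ K * (16 * N ^ 9) := by gcongr
        _ = N ^ 9 * (16 * K) := by ring
    have hNK' : (N : ℝ) ≤ 16 * K := by exact_mod_cast hNK
    have hx1 : 1 ≤ √(N : ℝ) := Real.one_le_sqrt.mpr (by exact_mod_cast hN)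
    calc _ ≤ ∑ _ ∈ latticeSet m, ∑ _ ∈ latticeSet m, ∑ _ ∈ latticeSet m, ∑ _ ∈ latticeSet m,
          (1 : ℝ) := by
          gcongr
          exact invNorm_le_one _
      _ = √N ^ 3 * √N ^ 5 := by
          rw [← pow_add, show 3 + 5 = 2 * 4 from rfl, pow_mul, ← hx2]
          simp only [Finset.sum_const, nsmul_eq_mul, hNdef, latN]
          ring
      _ ≤ √N ^ 4 * √N ^ 5 := by
          gcongr
          norm_num
      _ = (N : ℝ) ^ 2 * √N ^ 5 := by rw [show 4 = 2 * 2 from rfl, pow_mul, ← hx2]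
      _ ≤ (35 + (16 * K) ^ 2) * √N ^ 5 := by
          gcongr
          have : (N : ℝ) ^ 2 ≤ (16 * K) ^ 2 := by gcongr
          linarith

end
end

section
/- Let τ be a Borel probability measure on the unit circle S¹ ⊂ ℝ² which is invariant under rotation by π/2, and let γ : [0,L] → ℝ² be a smooth unit-speed curve (L > 0). Define A(γ,θ) = ∫₀ᴸ ⟨θ, γ'(t)⟩² dt for θ ∈ S¹, and c(τ,γ) = ∫_{S¹} A(γ,θ)² dτ(θ). Then: (i) L²/4 ≤ c(τ,γ) ≤ L²/2; and (ii) c(τ,γ) = L²/4 if and only if A(γ,θ) = L/2 for every θ in the support of τ. -/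
open MeasureTheory Real

noncomputable section

/-- The support of a measure: the smallest closed set of full measure. -/
def msupport (τ : MeasureTheory.Measure (ℝ × ℝ)) : Set (ℝ × ℝ) :=
  ⋂₀ {s : Set (ℝ × ℝ) | IsClosed s ∧ τ sᶜ = 0}

theorem measure_compl_msupport (τ : Measure (ℝ × ℝ)) : τ (msupport τ)ᶜ = 0 := by
  refine measure_null_of_locally_null _ fun x hx => ?_
  simp only [msupport, Set.mem_compl_iff, Set.mem_sInter, not_forall] at hx
  obtain ⟨s, ⟨hs, hs0⟩, hxs⟩ := hx
  exact ⟨sᶜ, mem_nhdsWithin_of_mem_nhds (hs.isOpen_compl.mem_nhds hxs), hs0⟩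

/-- A closed condition holds almost everywhere iff it holds on the support. -/
theorem ae_iff_forall_mem_msupport (τ : Measure (ℝ × ℝ)) {p : ℝ × ℝ → Prop}
    (hp : IsClosed {θ | p θ}) : (∀ᵐ θ ∂τ, p θ) ↔ ∀ θ ∈ msupport τ, p θ := by
  refine ⟨fun h θ hθ => hθ _ ⟨hp, ae_iff.mp h⟩, fun h => ?_⟩
  filter_upwards [ae_iff.mpr (measure_compl_msupport τ)] with θ hθ using h θ hθ

/-- A measurable function `f` with `0 ≤ f` and `f + f ∘ R = L` almost everywhere, where `R`
preserves the probability measure `τ`, has second moment between `L ^ 2 / 4` and `L ^ 2 / 2`,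
and the lower bound is attained exactly when `f = L / 2` almost everywhere. -/
theorem second_moment_bounds {Ω : Type*} [MeasurableSpace Ω] (τ : Measure Ω)
    [IsProbabilityMeasure τ] {R : Ω → Ω} (hR : MeasurePreserving R τ τ) {f : Ω → ℝ}
    (hf : Measurable f) (L : ℝ) (h0 : ∀ θ, 0 ≤ f θ) (hsum : ∀ᵐ θ ∂τ, f θ + f (R θ) = L) :
    (L ^ 2 / 4 ≤ ∫ θ, f θ ^ 2 ∂τ ∧ ∫ θ, f θ ^ 2 ∂τ ≤ L ^ 2 / 2) ∧
      (∫ θ, f θ ^ 2 ∂τ = L ^ 2 / 4 ↔ ∀ᵐ θ ∂τ, f θ = L / 2) := by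
  have hle : ∀ᵐ θ ∂τ, f θ ≤ L := hsum.mono fun θ h => by linarith [h0 (R θ)]
  have hint : Integrable f τ := by
    refine Integrable.of_bound hf.aestronglyMeasurable L (hle.mono fun θ h => ?_)
    rwa [norm_eq_abs, abs_of_nonneg (h0 θ)]
  have hint2 : Integrable (fun θ => f θ ^ 2) τ := by
    refine Integrable.of_bound (hf.pow_const 2).aestronglyMeasurable (L ^ 2)
      (hle.mono fun θ h => ?_)
    rw [norm_eq_abs, abs_of_nonneg (sq_nonneg _)]
    exact pow_le_pow_left₀ (h0 θ) h 2
  have hmean : ∫ θ, f θ ∂τ = L / 2 := by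
    have hcomp : ∫ θ, f (R θ) ∂τ = ∫ θ, f θ ∂τ := by
      conv_rhs => rw [← hR.map_eq]
      exact (integral_map hR.measurable.aemeasurable hf.aestronglyMeasurable).symm
    have h : ∫ θ, (f θ + f (R θ)) ∂τ = L := by
      rw [integral_congr_ae hsum]; simp
    have hintR : Integrable (fun θ => f (R θ)) τ := hR.integrable_comp_of_integrable hint
    rw [integral_add hint hintR, hcomp] at h
    linarith
  have hexpand : (fun θ => (f θ - L / 2) ^ 2) = fun θ => f θ ^ 2 - L * f θ + L ^ 2 / 4 := by
    ext θ; ring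
  have hint_sub : Integrable (fun θ => f θ ^ 2 - L * f θ) τ := hint2.sub (hint.const_mul L)
  have hvar_int : Integrable (fun θ => (f θ - L / 2) ^ 2) τ := by
    rw [hexpand]
    exact hint_sub.add (integrable_const _)
  have hvar : ∫ θ, (f θ - L / 2) ^ 2 ∂τ = ∫ θ, f θ ^ 2 ∂τ - L ^ 2 / 4 := by
    rw [hexpand, integral_add hint_sub (integrable_const _),
      integral_sub hint2 (hint.const_mul L), integral_const_mul, hmean]
    simp
    ring
  refine ⟨⟨?_, ?_⟩, ?_⟩
  · have : 0 ≤ ∫ θ, (f θ - L / 2) ^ 2 ∂τ := integral_nonneg fun θ => sq_nonneg _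
    linarith
  · calc ∫ θ, f θ ^ 2 ∂τ ≤ ∫ θ, L * f θ ∂τ :=
          integral_mono_ae hint2 (hint.const_mul L)
            (hle.mono fun θ h => by simpa [sq] using mul_le_mul_of_nonneg_right h (h0 θ))
      _ = L ^ 2 / 2 := by rw [integral_const_mul, hmean]; ring
  · rw [← sub_eq_zero, ← hvar, integral_eq_zero_iff_of_nonneg (fun θ => sq_nonneg _) hvar_int]
    refine Filter.eventually_congr (Filter.Eventually.of_forall fun θ => ?_)
    simp [sub_eq_zero]

/-- For a π/2-rotation invariant probability measure `τ` on the unit circle and a smooth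
unit-speed curve, `L²/4 ≤ c(τ,γ) ≤ L²/2`, with equality `c(τ,γ) = L²/4` iff
`A(γ,θ) = L/2` for all `θ` in the support of `τ`. -/
theorem leading_constant_bounds
    (L : ℝ) (hL : 0 < L) (γ : ℝ → ℝ × ℝ) (hγ : ContDiff ℝ (⊤ : ℕ∞) γ)
    (hunit : ∀ t ∈ Set.Icc (0:ℝ) L, (deriv γ t).1 ^ 2 + (deriv γ t).2 ^ 2 = 1)
    (τ : Measure (ℝ × ℝ)) (hprob : IsProbabilityMeasure τ)
    (hsphere : τ {θ : ℝ × ℝ | θ.1 ^ 2 + θ.2 ^ 2 = 1} = 1)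
    (hrot : Measure.map (fun θ : ℝ × ℝ => (-θ.2, θ.1)) τ = τ) :
    (L ^ 2 / 4 ≤
        ∫ θ, (∫ t in (0:ℝ)..L, (θ.1 * (deriv γ t).1 + θ.2 * (deriv γ t).2) ^ 2) ^ 2 ∂τ ∧
      (∫ θ, (∫ t in (0:ℝ)..L, (θ.1 * (deriv γ t).1 + θ.2 * (deriv γ t).2) ^ 2) ^ 2 ∂τ)
        ≤ L ^ 2 / 2) ∧
    ((∫ θ, (∫ t in (0:ℝ)..L, (θ.1 * (deriv γ t).1 + θ.2 * (deriv γ t).2) ^ 2) ^ 2 ∂τ)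
        = L ^ 2 / 4 ↔
      ∀ θ ∈ msupport τ,
        (∫ t in (0:ℝ)..L, (θ.1 * (deriv γ t).1 + θ.2 * (deriv γ t).2) ^ 2) = L / 2) := by
  have hd : Continuous (deriv γ) := hγ.continuous_deriv (by simp)
  have hcont : Continuous fun θ : ℝ × ℝ =>
      ∫ t in (0:ℝ)..L, (θ.1 * (deriv γ t).1 + θ.2 * (deriv γ t).2) ^ 2 :=
    intervalIntegral.continuous_parametric_intervalIntegral_of_continuous' (by fun_prop) _ _
  have hcircle : ∀ᵐ θ ∂τ, θ.1 ^ 2 + θ.2 ^ 2 = 1 := by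
    have hmeas : MeasurableSet {θ : ℝ × ℝ | θ.1 ^ 2 + θ.2 ^ 2 = 1} :=
      measurableSet_eq_fun (by fun_prop) (by fun_prop)
    exact (prob_compl_eq_zero_iff hmeas).mpr hsphere
  rw [← ae_iff_forall_mem_msupport τ (isClosed_eq hcont continuous_const)]
  refine second_moment_bounds τ (R := fun θ : ℝ × ℝ => (-θ.2, θ.1)) ⟨by fun_prop, hrot⟩
    hcont.measurable L
    (fun θ => intervalIntegral.integral_nonneg hL.le fun t _ => sq_nonneg _) ?_
  filter_upwards [hcircle] with θ hθ
  rw [← intervalIntegral.integral_add (Continuous.intervalIntegrable (by fun_prop) _ _)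
    (Continuous.intervalIntegrable (by fun_prop) _ _)]
  rw [intervalIntegral.integral_congr (g := fun _ => (1 : ℝ))]
  · simp
  · intro t ht
    rw [Set.uIcc_of_le hL.le] at ht
    have := hunit t ht
    linear_combination (θ.1 ^ 2 + θ.2 ^ 2) * this + hθ

end
end

section
/- Let γ : [0,L] → ℝ² be a smooth unit-speed curve (L > 0). Then c(τ,γ) = L²/4 holds for every Borel probability measure τ on the unit circle S¹ ⊂ ℝ² invariant under rotation by π/2, if and only if ∫₀ᴸ ( γ₁'(t) + i·γ₂'(t) )² dt = 0 (an identity of complex numbers), where γ' = (γ₁', γ₂'). -/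
open MeasureTheory Real

/-- The uniform probability measure on the orbit of `p` under the rotation by `π/2`. -/
noncomputable def quarterTurnOrbitMeasure (p : ℝ × ℝ) : Measure (ℝ × ℝ) :=
  (4⁻¹ : ENNReal) • (Measure.dirac p + Measure.dirac (-p.2, p.1) +
    Measure.dirac (-p.1, -p.2) + Measure.dirac (p.2, -p.1))

lemma isProbabilityMeasure_quarterTurnOrbitMeasure (p : ℝ × ℝ) :
    IsProbabilityMeasure (quarterTurnOrbitMeasure p) := by
  constructor
  simp only [quarterTurnOrbitMeasure, Measure.smul_apply, Measure.add_apply, measure_univ,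
    smul_eq_mul]
  norm_num
  exact ENNReal.inv_mul_cancel (by norm_num) (by norm_num)

lemma quarterTurnOrbitMeasure_circle {p : ℝ × ℝ} (hp : p.1 ^ 2 + p.2 ^ 2 = 1) :
    quarterTurnOrbitMeasure p {θ : ℝ × ℝ | θ.1 ^ 2 + θ.2 ^ 2 = 1} = 1 := by
  have hp' : p.2 ^ 2 + p.1 ^ 2 = 1 := by rw [add_comm, hp]
  simp only [quarterTurnOrbitMeasure, Measure.smul_apply, Measure.add_apply, smul_eq_mul,
    Measure.dirac_apply, Set.indicator, Set.mem_ofPred_eq, neg_sq, hp, hp', if_true, Pi.one_apply]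
  norm_num
  exact ENNReal.inv_mul_cancel (by norm_num) (by norm_num)

lemma map_quarterTurnOrbitMeasure (p : ℝ × ℝ) :
    Measure.map (fun θ : ℝ × ℝ => (-θ.2, θ.1)) (quarterTurnOrbitMeasure p) =
      quarterTurnOrbitMeasure p := by
  have hm : Measurable (fun θ : ℝ × ℝ => (-θ.2, θ.1)) := by fun_prop
  simp only [quarterTurnOrbitMeasure, Measure.map_smul, Measure.map_add _ _ hm,
    Measure.map_dirac' hm, neg_neg]
  congr 1
  abel

lemma integral_quarterTurnOrbitMeasure (p : ℝ × ℝ) (f : ℝ × ℝ → ℝ) :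
    ∫ θ, f θ ∂(quarterTurnOrbitMeasure p) =
      (f p + f (-p.2, p.1) + f (-p.1, -p.2) + f (p.2, -p.1)) / 4 := by
  have hi (q : ℝ × ℝ) : Integrable f (Measure.dirac q) := integrable_dirac (by simp)
  rw [quarterTurnOrbitMeasure, integral_smul_measure,
    integral_add_measure (((hi _).add_measure (hi _)).add_measure (hi _)) (hi _),
    integral_add_measure ((hi _).add_measure (hi _)) (hi _),
    integral_add_measure (hi _) (hi _)]
  simp only [integral_dirac, ENNReal.toReal_inv, ENNReal.toReal_ofNat, smul_eq_mul]
  ring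

lemma intervalIntegral_sq_linear_combination {u v : ℝ → ℝ} (hu : Continuous u)
    (hv : Continuous v) (a b x y : ℝ) :
    ∫ t in a..b, (x * u t + y * v t) ^ 2 =
      x ^ 2 * (∫ t in a..b, u t ^ 2) + 2 * x * y * (∫ t in a..b, u t * v t) +
        y ^ 2 * ∫ t in a..b, v t ^ 2 := by
  simp only [← intervalIntegral.integral_const_mul]
  rw [← intervalIntegral.integral_add, ← intervalIntegral.integral_add]
  · congr 1; ext t; ring
  all_goals exact Continuous.intervalIntegrable (by fun_prop) _ _

lemma intervalIntegral_complex_sq {u v : ℝ → ℝ} (hu : Continuous u)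
    (hv : Continuous v) (a b : ℝ) :
    ∫ t in a..b, ((u t : ℂ) + Complex.I * (v t : ℂ)) ^ 2 =
      (((∫ t in a..b, u t ^ 2) - ∫ t in a..b, v t ^ 2 : ℝ) : ℂ) +
        ((2 * ∫ t in a..b, u t * v t : ℝ) : ℂ) * Complex.I := by
  rw [← intervalIntegral.integral_sub, ← intervalIntegral.integral_const_mul,
    ← intervalIntegral.integral_ofReal, ← intervalIntegral.integral_ofReal,
    ← intervalIntegral.integral_mul_const, ← intervalIntegral.integral_add]
  · congr 1; ext t; push_cast; linear_combination (v t : ℂ) ^ 2 * Complex.I_sq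
  all_goals exact Continuous.intervalIntegrable (by fun_prop) _ _

/-- `c(τ,γ) = L²/4` holds for every π/2-rotation invariant probability measure `τ`
on the unit circle iff `∫₀ᴸ (γ₁'(t) + i γ₂'(t))² dt = 0`. -/
theorem universal_minimum_iff
    (L : ℝ) (hL : 0 < L) (γ : ℝ → ℝ × ℝ) (hγ : ContDiff ℝ (⊤ : ℕ∞) γ)
    (hunit : ∀ t ∈ Set.Icc (0:ℝ) L, (deriv γ t).1 ^ 2 + (deriv γ t).2 ^ 2 = 1) :
    (∀ τ : Measure (ℝ × ℝ), IsProbabilityMeasure τ →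
        τ {θ : ℝ × ℝ | θ.1 ^ 2 + θ.2 ^ 2 = 1} = 1 →
        Measure.map (fun θ : ℝ × ℝ => (-θ.2, θ.1)) τ = τ →
        (∫ θ, (∫ t in (0:ℝ)..L, (θ.1 * (deriv γ t).1 + θ.2 * (deriv γ t).2) ^ 2) ^ 2 ∂τ)
          = L ^ 2 / 4)
      ↔ (∫ t in (0:ℝ)..L, (((deriv γ t).1 : ℂ) + Complex.I * ((deriv γ t).2 : ℂ)) ^ 2) = 0 := by
  have hd : Continuous (deriv γ) := hγ.continuous_deriv (by simp)
  have hu : Continuous fun t => (deriv γ t).1 := hd.fst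
  have hv : Continuous fun t => (deriv γ t).2 := hd.snd
  have hac : (∫ t in (0:ℝ)..L, (deriv γ t).1 ^ 2) + ∫ t in (0:ℝ)..L, (deriv γ t).2 ^ 2 = L := by
    rw [← intervalIntegral.integral_add
      (Continuous.intervalIntegrable (by fun_prop) _ _)
      (Continuous.intervalIntegrable (by fun_prop) _ _)]
    rw [intervalIntegral.integral_congr (g := fun _ => (1 : ℝ))]
    · simp
    · intro t ht
      rw [Set.uIcc_of_le hL.le] at ht
      exact hunit t ht
  rw [intervalIntegral_complex_sq hu hv]
  simp only [intervalIntegral_sq_linear_combination hu hv]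
  generalize (∫ t in (0:ℝ)..L, (deriv γ t).1 ^ 2) = a at *
  generalize (∫ t in (0:ℝ)..L, (deriv γ t).2 ^ 2) = c at *
  generalize (∫ t in (0:ℝ)..L, (deriv γ t).1 * (deriv γ t).2) = b at *
  have hzero : (((a - c : ℝ) : ℂ) + ((2 * b : ℝ) : ℂ) * Complex.I = 0) ↔ a = c ∧ b = 0 := by
    rw [Complex.ext_iff]
    simp [sub_eq_zero]
  rw [hzero]
  constructor
  · intro h
    have key (x y : ℝ) (hxy : x ^ 2 + y ^ 2 = 1) :
        x ^ 2 * a + 2 * x * y * b + y ^ 2 * c = L / 2 := by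
      have := h _ (isProbabilityMeasure_quarterTurnOrbitMeasure (x, y))
        (quarterTurnOrbitMeasure_circle hxy) (map_quarterTurnOrbitMeasure _)
      rw [integral_quarterTurnOrbitMeasure] at this
      have hrot : y ^ 2 * a - 2 * x * y * b + x ^ 2 * c =
          L - (x ^ 2 * a + 2 * x * y * b + y ^ 2 * c) := by
        linear_combination (a + c) * hxy + hac
      have hsq : (x ^ 2 * a + 2 * x * y * b + y ^ 2 * c - L / 2) ^ 2 = 0 := by
        have hrot_sq := congrArg (· ^ 2) hrot
        simp only at hrot_sq this
        linear_combination this - hrot_sq / 2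
      linarith [pow_eq_zero_iff (two_ne_zero) |>.1 hsq]
    have h₁ := key 1 0 (by norm_num)
    have h₂ := key (3 / 5) (4 / 5) (by norm_num)
    constructor <;> linarith
  · rintro ⟨rfl, rfl⟩ τ hτ hcircle -
    have hae : ∀ᵐ θ ∂τ, θ.1 ^ 2 + θ.2 ^ 2 = 1 := by
      refine (mem_ae_iff_prob_eq_one ?_).2 hcircle
      exact measurableSet_eq_fun (by fun_prop) (by fun_prop)
    rw [integral_congr_ae (g := fun _ => L ^ 2 / 4)]
    · simp
    · filter_upwards [hae] with θ hθ
      have : θ.1 ^ 2 * a + 2 * θ.1 * θ.2 * 0 + θ.2 ^ 2 * a = L / 2 := by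
        linear_combination a * hθ + hac / 2
      rw [this]
      ring
end
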